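/- There exist real constants A > 0 and ε > 0 such that for every function k : ℕ → ℕ satisfying k(n) ≤ n for all n and lim_{n→∞} ( n²/4 − ε·n + A·√n − k(n)·(n − k(n)) ) = −∞ (condition (⋆)), the number N^M_{k(n),n} of monomial equivalence classes of k(n)-dimensional linear codes in F_q^n satisfies N^M_{k(n),n} ∼ binom(n, k(n))_q / ( n! · (q−1)^{n−1} ) as n → ∞. -/

import Mathlib

open Filter Matrix
open scoped Topology

/-- The `q`-binomial coefficient `binom(n,k)_q = ∏_{j=0}^{k-1} (q^{n-j}-1)/(q^{k-j}-1)`. -/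
noncomputable def qBinom (q n k : ℕ) : ℝ :=
  ∏ j ∈ Finset.range k, ((q : ℝ) ^ (n - j) - 1) / ((q : ℝ) ^ (k - j) - 1)

/-- `S(n) = ∑_{k=0}^n binom(n,k)_q`. -/
noncomputable def Sq (q n : ℕ) : ℝ := ∑ k ∈ Finset.range (n + 1), qBinom q n k

/-- `K_q = ∏_{j=1}^∞ (1 - q^{-j})`. -/
noncomputable def Kq (q : ℕ) : ℝ := ∏' j : ℕ, (1 - ((q : ℝ))⁻¹ ^ (j + 1))

/-- `K_q(k) = ∏_{j=1}^{k} (1 - q^{-j})`. -/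
noncomputable def KqTrunc (q k : ℕ) : ℝ := ∏ j ∈ Finset.range k, (1 - ((q : ℝ))⁻¹ ^ (j + 1))

/-- Jacobi theta constant `θ₂(w) = ∑_{k∈ℤ} w^{(k+1/2)²}`. -/
noncomputable def theta2 (w : ℝ) : ℝ := ∑' k : ℤ, w ^ (((k : ℝ) + 1/2) ^ 2)

/-- Jacobi theta constant `θ₃(w) = ∑_{k∈ℤ} w^{k²}`. -/
noncomputable def theta3 (w : ℝ) : ℝ := ∑' k : ℤ, w ^ ((k : ℝ) ^ 2)

/-- Condition (⋆): `n²/4 − ε·n + A·√n − k(n)(n−k(n)) → −∞`. -/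
def StarCond (A ε : ℝ) (k : ℕ → ℕ) : Prop :=
  Tendsto (fun n : ℕ =>
    (n : ℝ) ^ 2 / 4 - ε * n + A * Real.sqrt n - (k n : ℝ) * ((n : ℝ) - (k n : ℝ)))
    atTop atBot

/-- The set of permutation matrices inside `GL n F`. -/
def permSet (F : Type) [Field F] (n : ℕ) : Set (GL (Fin n) F) :=
  {M | ∃ σ : Equiv.Perm (Fin n), (M : Matrix (Fin n) (Fin n) F) = σ.permMatrix F}

/-- The set of invertible diagonal matrices inside `GL n F`. -/
def diagSet (F : Type) [Field F] (n : ℕ) : Set (GL (Fin n) F) :=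
  {M | ∃ d : Fin n → F, (M : Matrix (Fin n) (Fin n) F) = Matrix.diagonal d}

/-- The permutation group: subgroup of `GL n F` formed by the permutation matrices. -/
def PermGroup (F : Type) [Field F] (n : ℕ) : Subgroup (GL (Fin n) F) :=
  Subgroup.closure (permSet F n)

/-- The monomial group: subgroup of `GL n F` generated by permutation and diagonal matrices. -/
def MonomialGroup (F : Type) [Field F] (n : ℕ) : Subgroup (GL (Fin n) F) :=
  Subgroup.closure (permSet F n ∪ diagSet F n)

/-- Number of orbits of a subgroup `G ≤ GL n F` acting on the Grassmannian of
`k`-dimensional subspaces of `F^n` (by taking images of subspaces). -/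
noncomputable def numClassesDim {n : ℕ} (F : Type) [Field F]
    (G : Subgroup (GL (Fin n) F)) (k : ℕ) : ℕ :=
  Nat.card (Quot (fun V W : {V : Submodule F (Fin n → F) // Module.finrank F V = k} =>
    ∃ M ∈ G, Submodule.map (Matrix.toLin' (M : Matrix (Fin n) (Fin n) F)) V.1 = W.1))

/-- Number of orbits of a subgroup `G ≤ GL n F` acting on the set of all subspaces of `F^n`. -/
noncomputable def numClasses {n : ℕ} (F : Type) [Field F]
    (G : Subgroup (GL (Fin n) F)) : ℕ :=
  Nat.card (Quot (fun V W : Submodule F (Fin n → F) =>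
    ∃ M ∈ G, Submodule.map (Matrix.toLin' (M : Matrix (Fin n) (Fin n) F)) V = W))

/-- Semilinear orbit relation: `W` is the image of `V` under the semilinear transformation
given by applying the field automorphism `σ` componentwise followed by a monomial matrix. -/
def semiRel (F : Type) [Field F] (n : ℕ) (V W : Submodule F (Fin n → F)) : Prop :=
  ∃ σ : F ≃+* F, ∃ M ∈ MonomialGroup F n,
    (W : Set (Fin n → F)) =
      (fun x => Matrix.mulVec (M : Matrix (Fin n) (Fin n) F) (fun i => σ (x i))) '' (V : Set (Fin n → F))

/-- Number of semilinear equivalence classes of `k`-dimensional subspaces of `F^n`. -/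
noncomputable def numClassesDimSemi (F : Type) [Field F] (n k : ℕ) : ℕ :=
  Nat.card (Quot (fun V W : {V : Submodule F (Fin n → F) // Module.finrank F V = k} =>
    semiRel F n V.1 W.1))

/-- Number of semilinear equivalence classes of subspaces of `F^n`. -/
noncomputable def numClassesSemi (F : Type) [Field F] (n : ℕ) : ℕ :=
  Nat.card (Quot (fun V W : Submodule F (Fin n → F) => semiRel F n V W))

section SubspaceCounting

/-- The linearly independent families spanning a given `k`-dimensional subspace are the bases of
that subspace. -/
noncomputable def linearIndependentFiberEquiv {F M : Type} [Field F] [AddCommGroup M] [Module F M]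
    [Module.Finite F M] {k : ℕ} (V : Submodule F M) (hV : Module.finrank F V = k) :
    {s : {s : Fin k → M // LinearIndependent F s} // Submodule.span F (Set.range s.1) = V} ≃
      {s : Fin k → V // LinearIndependent F s} where
  toFun s := ⟨fun i => ⟨s.1.1 i, s.2.le (Submodule.subset_span ⟨i, rfl⟩)⟩,
    LinearIndependent.of_comp (Submodule.subtype _) s.1.2⟩
  invFun t := ⟨⟨fun i => (t.1 i : M), t.2.map' (Submodule.subtype _) (Submodule.ker_subtype _)⟩, by
    have h1 := t.2.span_eq_top_of_card_eq_finrank' (by simp [hV])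
    have h2 := congrArg (Submodule.map V.subtype) h1
    rw [Submodule.map_span, Submodule.map_top, Submodule.range_subtype, ← Set.range_comp] at h2
    exact h2⟩
  left_inv _ := rfl
  right_inv _ := rfl

variable {F M : Type} [Field F] [Fintype F] [AddCommGroup M] [Module F M] [Finite M]

theorem card_grassmannian_mul_prod {k : ℕ} (hk : k ≤ Module.finrank F M) :
    Nat.card {V : Submodule F M // Module.finrank F V = k} *
        ∏ i : Fin k, (Fintype.card F ^ k - Fintype.card F ^ i.val) =
      ∏ i : Fin k, (Fintype.card F ^ Module.finrank F M - Fintype.card F ^ i.val) := by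
  classical
  have : Module.Finite F M := Module.Finite.of_finite
  let f : {s : Fin k → M // LinearIndependent F s} →
      {V : Submodule F M // Module.finrank F V = k} :=
    fun s => ⟨Submodule.span F (Set.range s.1), by simpa using finrank_span_eq_card s.2⟩
  have := Fintype.ofFinite {V : Submodule F M // Module.finrank F V = k}
  rw [← card_linearIndependent hk, ← Nat.card_congr (Equiv.sigmaFiberEquiv f), Nat.card_sigma]
  rw [Finset.sum_congr rfl (g := fun _ => ∏ i : Fin k, (Fintype.card F ^ k - Fintype.card F ^ i.val))]
  · simp
  · rintro ⟨V, hV⟩ -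
    have e := linearIndependentFiberEquiv V hV
    rw [← Nat.card_congr (Equiv.subtypeEquivRight (fun s => by simp [f, Subtype.ext_iff])) |>.trans
      (Nat.card_congr e) |>.symm]
    rw [card_linearIndependent hV.ge, hV]

theorem card_grassmannian {k : ℕ} (hk : k ≤ Module.finrank F M) :
    (Nat.card {V : Submodule F M // Module.finrank F V = k} : ℝ) =
      qBinom (Fintype.card F) (Module.finrank F M) k := by
  have hq : 1 < Fintype.card F := Fintype.one_lt_card
  have hq' : (1 : ℝ) < Fintype.card F := by exact_mod_cast hq
  have h := congrArg (Nat.cast : ℕ → ℝ) (card_grassmannian_mul_prod (F := F) (M := M) hk)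
  generalize Fintype.card F = q at *
  generalize Module.finrank F M = n at *
  have key : ∀ m, k ≤ m → ((∏ i : Fin k, (q ^ m - q ^ i.val) : ℕ) : ℝ) =
      (∏ i ∈ Finset.range k, (q : ℝ) ^ i) * ∏ i ∈ Finset.range k, ((q : ℝ) ^ (m - i) - 1) := by
    intro m hm
    rw [Fin.prod_univ_eq_prod_range (fun i => q ^ m - q ^ i), ← Finset.prod_mul_distrib]
    push_cast
    refine Finset.prod_congr rfl fun i hi => ?_
    have hi' : i ≤ m := (Finset.mem_range.1 hi).le.trans hm
    rw [Nat.cast_sub (Nat.pow_le_pow_right hq.le hi'), mul_sub, ← pow_add, mul_one,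
      Nat.add_sub_cancel' hi']
    push_cast
    rfl
  rw [Nat.cast_mul, key k le_rfl, key n hk, mul_left_comm] at h
  have h1 : (∏ i ∈ Finset.range k, (q : ℝ) ^ i) ≠ 0 :=
    Finset.prod_ne_zero_iff.2 fun i _ => by positivity
  have h2 : (∏ i ∈ Finset.range k, ((q : ℝ) ^ (k - i) - 1)) ≠ 0 :=
    Finset.prod_ne_zero_iff.2 fun i hi => by
      have := one_lt_pow₀ hq' (Nat.sub_ne_zero_of_lt (Finset.mem_range.1 hi))
      linarith
  rw [qBinom, Finset.prod_div_distrib, eq_div_iff h2]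
  exact mul_left_cancel₀ h1 h

theorem pow_le_qBinom {q n k : ℕ} (hq : 2 ≤ q) (hk : k ≤ n) :
    (q : ℝ) ^ (k * (n - k)) ≤ qBinom q n k := by
  have hq' : (1 : ℝ) < q := by exact_mod_cast hq
  have h : (q : ℝ) ^ (k * (n - k)) = ∏ _j ∈ Finset.range k, (q : ℝ) ^ (n - k) := by
    rw [Finset.prod_const, Finset.card_range, ← pow_mul, mul_comm]
  rw [h, qBinom]
  refine Finset.prod_le_prod (fun _ _ => by positivity) fun j hj => ?_
  have hj' := Finset.mem_range.1 hj
  have hb : 1 < (q : ℝ) ^ (k - j) := one_lt_pow₀ hq' (Nat.sub_ne_zero_of_lt hj')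
  have ha : 1 ≤ (q : ℝ) ^ (n - k) := one_le_pow₀ hq'.le
  rw [le_div_iff₀ (by linarith), show n - j = (n - k) + (k - j) by omega, pow_add]
  linarith

theorem qBinom_le {q n k : ℕ} (hq : 2 ≤ q) (hk : k ≤ n) :
    qBinom q n k ≤ (k + 1) * (q : ℝ) ^ (k * (n - k)) := by
  have hq' : (1 : ℝ) < q := by exact_mod_cast hq
  have h : (k + 1) * (q : ℝ) ^ (k * (n - k)) =
      ∏ j ∈ Finset.range k, ((((k - 1 - j : ℕ) : ℝ) + 1 + 1) / (((k - 1 - j : ℕ) : ℝ) + 1) *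
        (q : ℝ) ^ (n - k)) := by
    rw [Finset.prod_mul_distrib, Finset.prod_const, Finset.card_range, ← pow_mul, mul_comm (n - k),
      Finset.prod_range_reflect (fun i : ℕ => ((i : ℝ) + 1 + 1) / ((i : ℝ) + 1))]
    congr 1
    clear hk
    induction k with
    | zero => simp
    | succ k ih =>
      rw [Finset.prod_range_succ, ← ih]
      push_cast
      field_simp
  rw [h, qBinom]
  have hb : ∀ j ∈ Finset.range k, 1 < (q : ℝ) ^ (k - j) := fun j hj =>
    one_lt_pow₀ hq' (Nat.sub_ne_zero_of_lt (Finset.mem_range.1 hj))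
  refine Finset.prod_le_prod (fun j hj => ?_) fun j hj => ?_
  · have := hb j hj
    have : 1 ≤ (q : ℝ) ^ (n - j) := one_le_pow₀ hq'.le
    exact div_nonneg (by linarith) (by linarith)
  have hj' := Finset.mem_range.1 hj
  obtain ⟨i, rfl⟩ : ∃ i, k = j + (i + 1) := ⟨k - j - 1, by omega⟩
  have hb' := hb j hj
  rw [show j + (i + 1) - 1 - j = i by omega, show n - j = (n - (j + (i + 1))) + (i + 1) by omega,
    pow_add]
  simp only [Nat.add_sub_cancel_left] at hb' ⊢
  have hib : (i : ℝ) + 1 + 1 ≤ (q : ℝ) ^ (i + 1) := by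
    have h1 : i + 1 < 2 ^ (i + 1) := Nat.lt_two_pow_self
    have h2 : 2 ^ (i + 1) ≤ q ^ (i + 1) := Nat.pow_le_pow_left hq _
    exact_mod_cast h1.trans_le h2
  have ha : 0 < (q : ℝ) ^ (n - (j + (i + 1))) := by positivity
  generalize (q : ℝ) ^ (n - (j + (i + 1))) = a at *
  generalize (q : ℝ) ^ (i + 1) = b at *
  rw [div_mul_eq_mul_div, div_le_div_iff₀ (by linarith) (by positivity)]
  nlinarith

variable (F M) in
theorem card_submodule_le :
    (Nat.card (Submodule F M) : ℝ) ≤ ((Module.finrank F M : ℝ) + 1) ^ 2 *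
      (Fintype.card F : ℝ) ^ ((Module.finrank F M : ℝ) ^ 2 / 4) := by
  have : Module.Finite F M := Module.Finite.of_finite
  have hq : 2 ≤ Fintype.card F := Fintype.one_lt_card
  have hq' : (1 : ℝ) ≤ Fintype.card F := by exact_mod_cast one_le_two.trans hq
  obtain ⟨n, hn⟩ : ∃ n, n = Module.finrank F M := ⟨_, rfl⟩
  rw [← hn]
  let f : Submodule F M → Fin (n + 1) :=
    fun V => ⟨Module.finrank F V, Nat.lt_succ_of_le (hn ▸ Submodule.finrank_le V)⟩
  rw [← Nat.card_congr (Equiv.sigmaFiberEquiv f), Nat.card_sigma]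
  push_cast
  calc _ ≤ ∑ _d : Fin (n + 1), ((n : ℝ) + 1) * (Fintype.card F : ℝ) ^ ((n : ℝ) ^ 2 / 4) := by
        refine Finset.sum_le_sum fun d _ => ?_
        have hd : (d : ℕ) ≤ n := Nat.lt_succ_iff.1 d.2
        have e : {V // f V = d} ≃ {V : Submodule F M // Module.finrank F V = d} :=
          Equiv.subtypeEquivRight fun V => by simp [f, Fin.ext_iff]
        rw [Nat.card_congr e, card_grassmannian (hn ▸ hd), ← hn]
        refine (qBinom_le hq hd).trans ?_
        refine mul_le_mul (by exact_mod_cast Nat.succ_le_succ hd) ?_ (by positivity) (by positivity)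
        rw [← Real.rpow_natCast]
        refine Real.rpow_le_rpow_of_exponent_le hq' ?_
        push_cast [Nat.cast_sub hd]
        nlinarith [sq_nonneg ((n : ℝ) - 2 * d)]
    _ = _ := by simp; ring

end SubspaceCounting

section StableSubspaces

variable {F M : Type} [Field F] [AddCommGroup M] [Module F M] [Finite M]

/-- Subspaces between `W` and `U` are bounded in number by the subspaces of `U ⧸ W`. -/
theorem card_Icc_submodule_le (W U : Submodule F M) :
    Nat.card (Set.Icc W U) ≤ Nat.card (Submodule F (U ⧸ W.submoduleOf U)) := by
  have : Finite (U ⧸ W.submoduleOf U) := Finite.of_surjective _ (W.submoduleOf U).mkQ_surjective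
  refine Nat.card_le_card_of_injective
    (fun V => (V.1.submoduleOf U).map (W.submoduleOf U).mkQ) ?_
  rintro ⟨V, hV⟩ ⟨V', hV'⟩ h
  have key : ∀ V ∈ Set.Icc W U,
      (((V.submoduleOf U).map (W.submoduleOf U).mkQ).comap (W.submoduleOf U).mkQ).map U.subtype
        = V := by
    intro V hV
    rw [Submodule.comap_map_mkQ, sup_eq_right.2 (Submodule.comap_mono hV.1)]
    simpa [Submodule.submoduleOf, Submodule.map_comap_subtype] using hV.2
  refine Subtype.ext ?_
  refine (key V hV).symm.trans (Eq.trans ?_ (key V' hV'))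
  exact congrArg (fun X => (Submodule.comap (W.submoduleOf U).mkQ X).map U.subtype) h

variable [Fintype F]

/-- Every `h`-stable subspace `V` lies between `W = h V` and `h⁻¹ W`, and `h⁻¹ W / W` has the
dimension of `ker h`. -/
theorem card_stable_submodule_le (h : M →ₗ[F] M) :
    (Nat.card {V : Submodule F M // V.map h ≤ V} : ℝ) ≤ ((Module.finrank F M : ℝ) + 1) ^ 4 *
      (Fintype.card F : ℝ) ^ (((Module.finrank F (LinearMap.range h) : ℝ) ^ 2 +
        (Module.finrank F (LinearMap.ker h) : ℝ) ^ 2) / 4) := by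
  classical
  have : Module.Finite F M := Module.Finite.of_finite
  have hq : (0 : ℝ) < Fintype.card F := by exact_mod_cast Fintype.card_pos
  have := Fintype.ofFinite (Submodule F (LinearMap.range h))
  let f : {V : Submodule F M // V.map h ≤ V} → Submodule F (LinearMap.range h) :=
    fun V => (V.1.map h).submoduleOf (LinearMap.range h)
  have hr : Module.finrank F (LinearMap.range h) ≤ Module.finrank F M := Submodule.finrank_le _
  have hk : Module.finrank F (LinearMap.ker h) ≤ Module.finrank F M := Submodule.finrank_le _
  set n := Module.finrank F M
  set r := Module.finrank F (LinearMap.range h) with hr_def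
  set s := Module.finrank F (LinearMap.ker h) with hs_def
  have fib : ∀ W : Submodule F (LinearMap.range h),
      (Nat.card {V // f V = W} : ℝ) ≤ ((s : ℝ) + 1) ^ 2 *
        (Fintype.card F : ℝ) ^ ((s : ℝ) ^ 2 / 4) := by
    intro W
    set W' := W.map (LinearMap.range h).subtype with hW'
    have hW'r : W' ≤ LinearMap.range h := Submodule.map_subtype_le _ _
    have hf : ∀ V : {V // f V = W}, V.1.1.map h = W' := by
      rintro ⟨⟨V, hV⟩, hVW⟩
      simp only [hW', ← hVW, f, Submodule.submoduleOf, Submodule.map_comap_subtype]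
      exact (inf_eq_right.2 (LinearMap.map_le_range)).symm
    have hmem : ∀ V : {V // f V = W}, V.1.1 ∈ Set.Icc W' (W'.comap h) := fun V =>
      ⟨hf V ▸ V.1.2, Submodule.map_le_iff_le_comap.1 (hf V).le⟩
    rcases isEmpty_or_nonempty {V // f V = W} with hE | ⟨⟨V₀⟩⟩
    · rw [Nat.card_of_isEmpty]
      simp only [Nat.cast_zero]
      positivity
    have hW : W' ≤ W'.comap h := (hmem V₀).1.trans (hmem V₀).2
    have h1 : Nat.card {V // f V = W} ≤ Nat.card (Set.Icc W' (W'.comap h)) :=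
      Nat.card_le_card_of_injective (fun V => ⟨V.1.1, hmem V⟩) fun V V' hV =>
        Subtype.ext (Subtype.ext (Subtype.ext_iff.1 hV :))
    have hdim : Module.finrank F (W'.comap h ⧸ W'.submoduleOf (W'.comap h)) = s := by
      have e1 := Submodule.finrank_quotient_add_finrank (W'.submoduleOf (W'.comap h))
      have e2 := LinearMap.finrank_range_add_finrank_ker (h.domRestrict (W'.comap h))
      have hker : LinearMap.ker h ≤ W'.comap h := LinearMap.ker_le_comap h
      rw [LinearMap.range_domRestrict, Submodule.map_comap_eq_of_le hW'r] at e2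
      have e3 : Module.finrank F (W'.submoduleOf (W'.comap h)) = Module.finrank F W' :=
        (Submodule.submoduleOfEquivOfLe hW).finrank_eq
      have e4 : Module.finrank F (LinearMap.ker (h.domRestrict (W'.comap h))) = s := by
        rw [LinearMap.ker_domRestrict]
        exact (Submodule.submoduleOfEquivOfLe hker).finrank_eq
      omega
    have : Finite (W'.comap h ⧸ W'.submoduleOf (W'.comap h)) :=
      Finite.of_surjective _ (Submodule.mkQ_surjective _)
    have h2 := card_submodule_le F (W'.comap h ⧸ W'.submoduleOf (W'.comap h))
    rw [hdim] at h2
    exact le_trans (by exact_mod_cast h1.trans (card_Icc_submodule_le _ _)) h2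
  rw [← Nat.card_congr (Equiv.sigmaFiberEquiv f), Nat.card_sigma]
  push_cast
  refine (Finset.sum_le_sum fun W _ => fib W).trans ?_
  rw [Finset.sum_const, nsmul_eq_mul, Finset.card_univ, ← Nat.card_eq_fintype_card]
  calc _ ≤ (((r : ℝ) + 1) ^ 2 * (Fintype.card F : ℝ) ^ ((r : ℝ) ^ 2 / 4)) *
        (((s : ℝ) + 1) ^ 2 * (Fintype.card F : ℝ) ^ ((s : ℝ) ^ 2 / 4)) := by
        gcongr
        exact card_submodule_le F (LinearMap.range h)
    _ = (((r : ℝ) + 1) ^ 2 * ((s : ℝ) + 1) ^ 2) *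
        (Fintype.card F : ℝ) ^ (((r : ℝ) ^ 2 + (s : ℝ) ^ 2) / 4) := by
        rw [add_div, Real.rpow_add hq]; ring
    _ ≤ (((n : ℝ) + 1) ^ 2 * ((n : ℝ) + 1) ^ 2) *
        (Fintype.card F : ℝ) ^ (((r : ℝ) ^ 2 + (s : ℝ) ^ 2) / 4) := by
        gcongr
    _ = _ := by ring

end StableSubspaces

section CyclicExtension

variable {F M : Type} [Field F] [AddCommGroup M] [Module F M]

theorem aeval_mem_of_map_le {g : Module.End F M} {V : Submodule F M} (hV : V.map g ≤ V)
    (p : Polynomial F) {v : M} (hv : v ∈ V) : Polynomial.aeval g p v ∈ V := by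
  induction p using Polynomial.induction_on' with
  | add p r hp hr => simpa using V.add_mem hp hr
  | monomial m a =>
    have : ∀ m : ℕ, (g ^ m) v ∈ V := by
      intro m
      induction m with
      | zero => simpa
      | succ m ih =>
        rw [pow_succ', Module.End.mul_apply]
        exact hV ⟨_, ih, rfl⟩
    simpa [Polynomial.aeval_monomial] using V.smul_mem a (this m)

/-- The subspace of all `p(g) e` for polynomials `p`. -/
noncomputable def cyclicSpan (g : Module.End F M) (e : M) : Submodule F M :=
  LinearMap.range ((LinearMap.applyₗ e).comp (Polynomial.aeval g).toLinearMap)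

theorem mem_cyclicSpan {g : Module.End F M} {e u : M} :
    u ∈ cyclicSpan g e ↔ ∃ p : Polynomial F, Polynomial.aeval g p e = u := by
  simp [cyclicSpan]

/-- A stable subspace of a cyclic extension of `N` is generated by one vector modulo `N`. -/
theorem exists_generator_mod {g : Module.End F M} {N V : Submodule F M} {e : M}
    (hN : N.map g ≤ N) (hV : V.map g ≤ V) (hVN : V ≤ N ⊔ cyclicSpan g e) :
    ∃ v ∈ V, V = (V ⊓ N) ⊔ cyclicSpan g v := by
  let I : Ideal (Polynomial F) :=
    { carrier := {p | ∃ u ∈ V, u - Polynomial.aeval g p e ∈ N}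
      zero_mem' := ⟨0, by simp⟩
      add_mem' := by
        rintro p r ⟨u, hu, hup⟩ ⟨w, hw, hwr⟩
        refine ⟨u + w, V.add_mem hu hw, ?_⟩
        convert N.add_mem hup hwr using 1
        simp; abel
      smul_mem' := by
        rintro a p ⟨u, hu, hup⟩
        refine ⟨Polynomial.aeval g a u, aeval_mem_of_map_le hV a hu, ?_⟩
        convert aeval_mem_of_map_le hN a hup using 1
        simp }
  obtain ⟨p₀, hp₀⟩ := (IsPrincipalIdealRing.principal I).principal
  have hp₀I : p₀ ∈ I := hp₀ ▸ Submodule.mem_span_singleton_self p₀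
  obtain ⟨v, hv, hvp⟩ := hp₀I
  refine ⟨v, hv, le_antisymm ?_ (sup_le inf_le_left ?_)⟩
  · intro u hu
    obtain ⟨y, hy, z, hz, hyz⟩ := Submodule.mem_sup.1 (hVN hu)
    obtain ⟨p, rfl⟩ := mem_cyclicSpan.1 hz
    have hpI : p ∈ I := ⟨u, hu, by simpa [← hyz] using hy⟩
    rw [hp₀] at hpI
    obtain ⟨a, rfl⟩ := Submodule.mem_span_singleton.1 hpI
    refine Submodule.mem_sup.2 ⟨u - Polynomial.aeval g a v,
      ⟨V.sub_mem hu (aeval_mem_of_map_le hV a hv), ?_⟩, Polynomial.aeval g a v,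
      mem_cyclicSpan.2 ⟨a, rfl⟩, by simp⟩
    have := N.sub_mem hy (aeval_mem_of_map_le hN a hvp)
    have heq : u - Polynomial.aeval g a v =
        y - Polynomial.aeval g a (v - Polynomial.aeval g p₀ e) := by
      rw [← hyz]
      simp only [smul_eq_mul, map_mul, map_sub, Module.End.mul_apply]
      abel
    exact heq ▸ this
  · intro u hu
    obtain ⟨a, rfl⟩ := mem_cyclicSpan.1 hu
    exact aeval_mem_of_map_le hV a hv

variable [Finite M]

theorem finite_stable (g : Module.End F M) (N : Submodule F M) :
    {V : Submodule F M | V ≤ N ∧ V.map g ≤ V}.Finite := Set.toFinite _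

/-- The `g`-stable subspaces of `N`. -/
noncomputable def stableFinset (g : Module.End F M) (N : Submodule F M) :
    Finset (Submodule F M) :=
  (finite_stable g N).toFinset

theorem mem_stableFinset {g : Module.End F M} {N V : Submodule F M} :
    V ∈ stableFinset g N ↔ V ≤ N ∧ V.map g ≤ V := by
  simp [stableFinset]

variable [Fintype F]

/-- The number of stable subspaces of `N`, weighted by powers of their codimension in `N`. -/
noncomputable def stableSum (g : Module.End F M) (N : Submodule F M) (p : ℕ) : ℝ :=
  ∑ V ∈ stableFinset g N,
    (Fintype.card F : ℝ) ^ (p * (Module.finrank F N - Module.finrank F V))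

theorem card_stable_fiber_le {g : Module.End F M} {N N' : Submodule F M} {e : M}
    (hN : N.map g ≤ N) (hN' : N' ≤ N ⊔ cyclicSpan g e) {W : Submodule F M} (hWN : W ≤ N')
    (s : Finset (Submodule F M)) (hs : ∀ V ∈ s, V ∈ stableFinset g N' ∧ V ⊓ N = W) :
    s.card ≤ Fintype.card F ^ (Module.finrank F N' - Module.finrank F W) := by
  classical
  have : Module.Finite F M := Module.Finite.of_finite
  have hgen : ∀ V : s, ∃ v ∈ V.1, V.1 = W ⊔ cyclicSpan g v := by
    rintro ⟨V, hVs⟩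
    obtain ⟨hV, rfl⟩ := hs V hVs
    rw [mem_stableFinset] at hV
    exact exists_generator_mod hN hV.2 (hV.1.trans hN')
  choose v hv hVv using hgen
  have hvN' : ∀ V : s, v V ∈ N' := fun V => (mem_stableFinset.1 (hs V V.2).1).1 (hv V)
  have hinj : Function.Injective
      (fun V : s => (W.submoduleOf N').mkQ ⟨v V, hvN' V⟩) := by
    have key : ∀ V V' : s, (W.submoduleOf N').mkQ ⟨v V, hvN' V⟩ =
        (W.submoduleOf N').mkQ ⟨v V', hvN' V'⟩ → V.1 ≤ V'.1 := by
      intro V V' h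
      have h' : v V - v V' ∈ W := (Submodule.Quotient.eq (W.submoduleOf N')).1 h
      have hWV : W ≤ V'.1 := by rw [hVv V']; exact le_sup_left
      have hvV : v V ∈ V'.1 := by
        have := V'.1.add_mem (hWV h') (hv V')
        simpa using this
      rw [hVv V]
      refine sup_le hWV fun u hu => ?_
      obtain ⟨a, rfl⟩ := mem_cyclicSpan.1 hu
      exact aeval_mem_of_map_le (mem_stableFinset.1 (hs V' V'.2).1).2 a hvV
    exact fun V V' h => Subtype.ext (le_antisymm (key V V' h) (key V' V h.symm))
  have : Finite (N' ⧸ W.submoduleOf N') := Finite.of_surjective _ (Submodule.mkQ_surjective _)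
  have h1 := Nat.card_le_card_of_injective _ hinj
  have h2 := Submodule.finrank_quotient_add_finrank (W.submoduleOf N')
  rw [show Module.finrank F (W.submoduleOf N') = Module.finrank F W from
    (Submodule.submoduleOfEquivOfLe hWN).finrank_eq] at h2
  rw [Module.natCard_eq_pow_finrank (K := F) (V := N' ⧸ W.submoduleOf N'),
    Nat.card_eq_fintype_card, Nat.card_eq_fintype_card, Fintype.card_coe] at h1
  rwa [← h2, Nat.add_sub_cancel]

theorem stableSum_le {g : Module.End F M} {N N' : Submodule F M} {e : M}
    (hN : N.map g ≤ N) (hNN' : N ≤ N') (hN' : N' ≤ N ⊔ cyclicSpan g e) {l : ℕ}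
    (hl : Module.finrank F N' = Module.finrank F N + (l + 1)) (p : ℕ) :
    stableSum g N' p ≤ (Fintype.card F : ℝ) ^ (p * (l + 1)) * stableSum g N p +
      (Fintype.card F : ℝ) ^ (l + 1 + p * l) * stableSum g N (p + 1) := by
  classical
  have : Module.Finite F M := Module.Finite.of_finite
  have hq : (1 : ℝ) ≤ Fintype.card F := by exact_mod_cast Fintype.card_pos
  rw [stableSum, ← Finset.sum_fiberwise_of_maps_to (t := stableFinset g N) (g := fun V => V ⊓ N)]
  · rw [stableSum, stableSum, Finset.mul_sum, Finset.mul_sum, ← Finset.sum_add_distrib]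
    refine Finset.sum_le_sum fun W hW => ?_
    obtain ⟨hWN, hWg⟩ := mem_stableFinset.1 hW
    have hdW : Module.finrank F W ≤ Module.finrank F N := Submodule.finrank_mono hWN
    obtain ⟨c, hc⟩ := Nat.exists_eq_add_of_le hdW
    have hWmem : W ∈ (stableFinset g N').filter fun V => V ⊓ N = W := by
      simp [mem_stableFinset, hWN.trans hNN', hWg, hWN]
    rw [← Finset.add_sum_erase _ _ hWmem]
    refine add_le_add (le_of_eq ?_) ?_
    · rw [← pow_add, hl, hc]
      congr 1
      rw [show Module.finrank F W + c + (l + 1) - Module.finrank F W = (l + 1) + c by omega,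
        Nat.add_sub_cancel_left]
      ring
    · refine (Finset.sum_le_card_nsmul _ _ ((Fintype.card F : ℝ) ^ (p * (c + l))) ?_).trans ?_
      · intro V hV
        obtain ⟨hVW, hV⟩ := Finset.mem_erase.1 hV
        obtain ⟨hV, rfl⟩ := Finset.mem_filter.1 hV
        have hlt : V ⊓ N < V := lt_of_le_of_ne inf_le_left hVW.symm
        have := Submodule.finrank_lt_finrank_of_lt hlt
        exact pow_le_pow_right₀ hq (Nat.mul_le_mul_left _ (by omega))
      · have h1 := card_stable_fiber_le hN hN' (hWN.trans hNN')
          (((stableFinset g N').filter fun V => V ⊓ N = W).erase W)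
          fun V hV => Finset.mem_filter.1 (Finset.mem_of_mem_erase hV)
        rw [nsmul_eq_mul]
        calc _ ≤ (Fintype.card F : ℝ) ^ (Module.finrank F N' - Module.finrank F W) *
              (Fintype.card F : ℝ) ^ (p * (c + l)) := by
              gcongr
              exact_mod_cast h1
          _ = _ := by
              rw [← pow_add, ← pow_add, hl, hc]
              congr 1
              rw [show Module.finrank F W + c + (l + 1) - Module.finrank F W = (l + 1) + c by omega,
                Nat.add_sub_cancel_left]
              ring
  · intro V hV
    obtain ⟨hVN, hVg⟩ := mem_stableFinset.1 hV
    exact mem_stableFinset.2 ⟨inf_le_right, (Submodule.map_inf_le g).trans (inf_le_inf hVg hN)⟩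

end CyclicExtension

section MonomialMaps

variable {F : Type} [Field F] {n : ℕ}

/-- The monomial map `x ↦ (i ↦ d i * x (σ i))`. -/
def monomialMap (d : Fin n → Fˣ) (σ : Equiv.Perm (Fin n)) : Module.End F (Fin n → F) where
  toFun x i := d i * x (σ i)
  map_add' x y := by ext i; simp [mul_add]
  map_smul' c x := by ext i; simp [mul_left_comm]

@[simp]
theorem monomialMap_apply (d : Fin n → Fˣ) (σ : Equiv.Perm (Fin n)) (x : Fin n → F) (i : Fin n) :
    monomialMap d σ x i = d i * x (σ i) := rfl

/-- The coordinate subspace of vectors supported in `T`. -/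
def coordSubspace (F : Type) [Field F] {n : ℕ} (T : Finset (Fin n)) : Submodule F (Fin n → F) where
  carrier := {x | ∀ i ∉ T, x i = 0}
  zero_mem' := by simp
  add_mem' := by
    intro x y hx hy i hi
    simp [hx i hi, hy i hi]
  smul_mem' := by
    intro c x hx i hi
    simp [hx i hi]

/-- Vectors supported in `T` are functions on `T`. -/
noncomputable def coordSubspaceEquiv (F : Type) [Field F] {n : ℕ} (T : Finset (Fin n)) :
    coordSubspace F T ≃ₗ[F] (T → F) := by
  classical
  exact
  { toFun := fun x i => x.1 i
    map_add' := fun _ _ => rfl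
    map_smul' := fun _ _ => rfl
    invFun := fun y => ⟨fun i => if h : i ∈ T then y ⟨i, h⟩ else 0, fun i hi => by simp [hi]⟩
    left_inv := by
      rintro ⟨x, hx⟩
      ext i
      by_cases hi : i ∈ T
      · simp [hi]
      · simp [hi, hx i hi]
    right_inv := by
      intro y
      ext i
      simp }

theorem finrank_coordSubspace (T : Finset (Fin n)) :
    Module.finrank F (coordSubspace F T) = T.card := by
  rw [(coordSubspaceEquiv F T).finrank_eq, Module.finrank_fintype_fun_eq_card, Fintype.card_coe]

theorem map_coordSubspace_le (d : Fin n → Fˣ) {σ : Equiv.Perm (Fin n)} {T : Finset (Fin n)}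
    (hT : ∀ i, σ i ∈ T ↔ i ∈ T) :
    (coordSubspace F T).map (monomialMap d σ) ≤ coordSubspace F T := by
  rintro _ ⟨x, hx, rfl⟩ i hi
  rw [monomialMap_apply, hx (σ i) (fun h => hi ((hT i).1 h)), mul_zero]

theorem monomialMap_single (d : Fin n → Fˣ) (σ : Equiv.Perm (Fin n)) (j : Fin n) (c : F) :
    monomialMap d σ (Pi.single (σ j) c) = Pi.single j (d j * c) := by
  ext i
  by_cases h : i = j
  · subst h; simp
  · simp [h]

theorem single_mem_cyclicSpan (d : Fin n → Fˣ) {σ : Equiv.Perm (Fin n)} {i j : Fin n}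
    (h : σ.SameCycle j i) (c : F) :
    (Pi.single j c : Fin n → F) ∈ cyclicSpan (monomialMap d σ) (Pi.single i 1) := by
  classical
  obtain ⟨m, hm⟩ := h.exists_nat_pow_eq
  have key : ∀ (m : ℕ) (j : Fin n), (σ ^ m) j = i → ∃ u : Fˣ,
      ((monomialMap d σ) ^ m) (Pi.single i 1) = (Pi.single j (u : F) : Fin n → F) := by
    intro m
    induction m with
    | zero => rintro j rfl; exact ⟨1, by simp⟩
    | succ m ih =>
      intro j hj
      obtain ⟨u, hu⟩ := ih (σ j) (by rwa [pow_succ, Equiv.Perm.mul_apply] at hj)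
      refine ⟨d j * u, ?_⟩
      rw [pow_succ', Module.End.mul_apply, hu, monomialMap_single]
      simp
  obtain ⟨u, hu⟩ := key m j hm
  refine mem_cyclicSpan.2 ⟨Polynomial.C (c * (u⁻¹ : Fˣ)) * Polynomial.X ^ m, ?_⟩
  simp only [map_mul, Polynomial.aeval_C, map_pow, Polynomial.aeval_X, Module.End.mul_apply, hu,
    Module.algebraMap_end_apply]
  rw [← Pi.single_smul']
  simp [← Pi.single_smul']

theorem coordSubspace_le_sup_cyclicSpan (d : Fin n → Fˣ) {σ : Equiv.Perm (Fin n)}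
    {T T₀ : Finset (Fin n)} {i : Fin n} (hT : ∀ j ∈ T, j ∉ T₀ → σ.SameCycle j i) :
    coordSubspace F T ≤
      coordSubspace F T₀ ⊔ cyclicSpan (monomialMap d σ) (Pi.single i 1) := by
  classical
  intro x hx
  rw [← Finset.univ_sum_single x]
  refine Submodule.sum_mem _ fun j _ => ?_
  by_cases hjT : j ∈ T
  · by_cases hj : j ∈ T₀
    · refine Submodule.mem_sup_left fun k hk => ?_
      rw [Pi.single_apply, if_neg]
      rintro rfl
      exact hk hj
    · exact Submodule.mem_sup_right (single_mem_cyclicSpan d (hT j hjT hj) _)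
  · rw [hx j hjT, Pi.single_zero]
    exact Submodule.zero_mem _

/-- The quadratic exponent bounding the weighted count of stable subspaces. -/
noncomputable def stableExponent (t p : ℝ) : ℝ := t * p + max (t - p) 0 ^ 2 / 6

theorem stableExponent_add_le {t p l : ℝ} (hl : 0 ≤ l) :
    p * l + stableExponent t p ≤ stableExponent (t + l) p := by
  have : max (t - p) 0 ^ 2 ≤ max (t + l - p) 0 ^ 2 := by
    gcongr
    linarith
  simp only [stableExponent]
  linarith

theorem stableExponent_succ_le {t p l N : ℝ} (hl : 0 ≤ l) (ht : t ≤ N) (hp : 0 ≤ p) :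
    p * l + stableExponent t (p + 1) ≤ stableExponent (t + (l + 1)) p + N := by
  have : max (t - (p + 1)) 0 ^ 2 ≤ max (t + (l + 1) - p) 0 ^ 2 := by
    refine pow_le_pow_left₀ (le_max_right _ _) (max_le_max_right _ ?_) 2
    linarith
  simp only [stableExponent]
  nlinarith

theorem stableExponent_succ_le' {t p l : ℝ} (hl : 1 ≤ l) :
    p * l + stableExponent t (p + 1) ≤ stableExponent (t + (l + 1)) p := by
  have : max (t + 2 - p) 0 ^ 2 ≤ max (t + (l + 1) - p) 0 ^ 2 := by
    gcongr
    linarith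
  have key : t - p + max (t - (p + 1)) 0 ^ 2 / 6 ≤ max (t + 2 - p) 0 ^ 2 / 6 := by
    rcases le_total (t - (p + 1)) 0 with h | h
    · rw [max_eq_right h]
      rcases le_total (t + 2 - p) 0 with h' | h'
      · rw [max_eq_right h']; linarith
      · rw [max_eq_left h']; nlinarith [sq_nonneg (t - p - 1)]
    · rw [max_eq_left h, max_eq_left (by linarith)]; nlinarith
  simp only [stableExponent]
  nlinarith

variable [Fintype F]

theorem stableSum_coordSubspace_le (d : Fin n → Fˣ) (σ : Equiv.Perm (Fin n)) (T : Finset (Fin n))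
    (hT : ∀ i, σ i ∈ T ↔ i ∈ T) (p : ℕ) :
    stableSum (monomialMap d σ) (coordSubspace F T) p ≤
      (Fintype.card F : ℝ) ^ (2 * (T.card : ℝ) + stableExponent T.card p +
        n * ((T.filter fun i => σ i = i).card : ℝ)) := by
  classical
  have hq : (2 : ℝ) ≤ Fintype.card F := by exact_mod_cast Fintype.one_lt_card (α := F)
  have hq1 : (1 : ℝ) ≤ Fintype.card F := one_le_two.trans hq
  have hq0 : (0 : ℝ) < Fintype.card F := one_pos.trans_le hq1
  induction hc : T.card using Nat.strong_induction_on generalizing T p with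
  | _ c ih =>
  subst hc
  rcases T.eq_empty_or_nonempty with rfl | ⟨i, hi⟩
  · have h0 : coordSubspace F (∅ : Finset (Fin n)) = ⊥ := by
      rw [eq_bot_iff]
      exact fun x hx => funext fun j => hx j (by simp)
    have hs : stableFinset (monomialMap d σ) (⊥ : Submodule F (Fin n → F)) = {⊥} := by
      ext V
      simp only [mem_stableFinset, le_bot_iff, Finset.mem_singleton]
      exact ⟨fun h => h.1, by rintro rfl; simp⟩
    rw [h0, stableSum, hs]
    simp [stableExponent]
  set T₀ := T.filter fun j => ¬ σ.SameCycle j i with hT₀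
  have hT₀c : ∀ j, σ j ∈ T₀ ↔ j ∈ T₀ := fun j => by
    simp [hT₀, hT, Equiv.Perm.sameCycle_apply_left]
  have hsub : T₀ ⊆ T := Finset.filter_subset _ _
  have hi₀ : i ∉ T₀ := by simp [hT₀, Equiv.Perm.SameCycle.refl]
  have hlt : T₀.card < T.card := Finset.card_lt_card ⟨hsub, fun h => hi₀ (h hi)⟩
  obtain ⟨l, hl⟩ : ∃ l, T.card = T₀.card + (l + 1) := ⟨T.card - T₀.card - 1, by omega⟩
  have hstep := stableSum_le (map_coordSubspace_le (F := F) d hT₀c)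
    (show coordSubspace F T₀ ≤ coordSubspace F T from fun x hx j hj => hx j fun h => hj (hsub h))
    (coordSubspace_le_sup_cyclicSpan (F := F) d (T := T) (T₀ := T₀) (i := i) fun j hj hj₀ => by
      simpa [hT₀, hj] using hj₀)
    (l := l) (by simpa [finrank_coordSubspace] using hl) p
  refine hstep.trans ?_
  have hf₀ : (T₀.filter fun j => σ j = j).card ≤ (T.filter fun j => σ j = j).card :=
    Finset.card_le_card (Finset.filter_subset_filter _ hsub)
  have hf₁ : l = 0 → (T₀.filter fun j => σ j = j).card + 1 ≤
      (T.filter fun j => σ j = j).card := by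
    rintro rfl
    have hfix : σ i = i := by
      by_contra hne
      have h1 : insert i (insert (σ i) T₀) ⊆ T := by
        simp [Finset.insert_subset_iff, hi, hsub, hT]
      have h2 := Finset.card_le_card h1
      rw [Finset.card_insert_of_notMem (by simp [hi₀, Ne.symm hne]),
        Finset.card_insert_of_notMem (by rwa [hT₀c])] at h2
      omega
    rw [← Finset.card_insert_of_notMem (a := i) (by simp [hi₀])]
    refine Finset.card_le_card ?_
    rw [Finset.insert_subset_iff]
    exact ⟨by simp [hi, hfix], Finset.filter_subset_filter _ hsub⟩
  have ih1 := ih _ hlt T₀ hT₀c p rfl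
  have ih2 := ih _ hlt T₀ hT₀c (p + 1) rfl
  have htn : (T₀.card : ℝ) ≤ n := by
    exact_mod_cast (Finset.card_le_univ T₀).trans_eq (Fintype.card_fin n)
  have hTr : (T.card : ℝ) = T₀.card + (l + 1) := by exact_mod_cast hl
  have hf₀r : ((T₀.filter fun j => σ j = j).card : ℝ) ≤ (T.filter fun j => σ j = j).card := by
    exact_mod_cast hf₀
  have hf₁r : l = 0 → ((T₀.filter fun j => σ j = j).card : ℝ) + 1 ≤
      (T.filter fun j => σ j = j).card := fun h => by exact_mod_cast hf₁ h
  set f₀ := ((T₀.filter fun j => σ j = j).card : ℝ)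
  set f := ((T.filter fun j => σ j = j).card : ℝ)
  set Q := (Fintype.card F : ℝ)
  set E := (2 * (T.card : ℝ) + stableExponent T.card p + n * f) - 1 with hE
  have hnf : (n : ℝ) * f₀ ≤ n * f := mul_le_mul_of_nonneg_left hf₀r (Nat.cast_nonneg n)
  have b1 : Q ^ (p * (l + 1)) * stableSum (monomialMap d σ) (coordSubspace F T₀) p ≤ Q ^ E := by
    refine (mul_le_mul_of_nonneg_left ih1 (by positivity)).trans ?_
    rw [← Real.rpow_natCast, ← Real.rpow_add hq0]
    refine Real.rpow_le_rpow_of_exponent_le hq1 ?_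
    have := stableExponent_add_le (t := T₀.card) (p := p) (l := l + 1) (by positivity)
    rw [hE, hTr]
    push_cast
    linarith
  have b2 : Q ^ (l + 1 + p * l) * stableSum (monomialMap d σ) (coordSubspace F T₀) (p + 1)
      ≤ Q ^ E := by
    refine (mul_le_mul_of_nonneg_left ih2 (by positivity)).trans ?_
    rw [← Real.rpow_natCast, ← Real.rpow_add hq0]
    refine Real.rpow_le_rpow_of_exponent_le hq1 ?_
    rw [hE, hTr]
    push_cast
    rcases Nat.eq_zero_or_pos l with h0 | h0
    · have h1 := hf₁r h0
      have h2 := mul_le_mul_of_nonneg_left h1 (Nat.cast_nonneg (α := ℝ) n)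
      have := stableExponent_succ_le (t := T₀.card) (p := p) (l := l) (N := n)
        (by positivity) htn (by positivity)
      linarith
    · have := stableExponent_succ_le' (t := T₀.card) (p := p) (l := l) (by exact_mod_cast h0)
      linarith
  calc _ ≤ Q ^ E + Q ^ E := add_le_add b1 b2
    _ ≤ Q * Q ^ E := by nlinarith [Real.rpow_pos_of_pos hq0 E]
    _ = _ := by
      rw [mul_comm, ← Real.rpow_add_one hq0.ne', hE, sub_add_cancel]

end MonomialMaps

section MonomialFixedSpaces

variable {F : Type} [Field F] {n : ℕ}

/-- The coordinates at which a monomial map differs from the scalar `c`. -/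
def nonscalarSet [DecidableEq F] (c : Fˣ) (d : Fin n → Fˣ) (σ : Equiv.Perm (Fin n)) :
    Finset (Fin n) :=
  Finset.univ.filter fun i => ¬ (d i = c ∧ σ i = i)

theorem finrank_ker_ge [DecidableEq F] (c : Fˣ) (d : Fin n → Fˣ) (σ : Equiv.Perm (Fin n)) :
    n ≤ Module.finrank F (LinearMap.ker (monomialMap d σ - algebraMap F _ (c : F))) +
      (nonscalarSet c d σ).card := by
  have h : coordSubspace F (nonscalarSet c d σ)ᶜ ≤
      LinearMap.ker (monomialMap d σ - algebraMap F _ (c : F)) := by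
    intro x hx
    rw [LinearMap.mem_ker]
    ext i
    simp only [LinearMap.sub_apply, monomialMap_apply, Module.algebraMap_end_apply, Pi.sub_apply,
      Pi.smul_apply, smul_eq_mul, Pi.zero_apply]
    by_cases hi : i ∈ nonscalarSet c d σ
    · have h1 : x i = 0 := hx i (by simpa using hi)
      have h2 : x (σ i) = 0 := hx (σ i) (by
        simp only [nonscalarSet, Finset.mem_compl, Finset.mem_filter, Finset.mem_univ, true_and,
          not_not, EmbeddingLike.apply_eq_iff_eq] at hi ⊢
        rintro ⟨h3, h4⟩
        rw [h4] at h3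
        exact hi ⟨h3, h4⟩)
      simp [h1, h2]
    · simp only [nonscalarSet, Finset.mem_filter, Finset.mem_univ, true_and, not_not] at hi
      simp [hi.1, hi.2]
  have h1 := Submodule.finrank_mono h
  rw [finrank_coordSubspace, Finset.card_compl, Fintype.card_fin] at h1
  omega

theorem finrank_ker_le_card {g : Module.End F (Fin n → F)} (T : Finset (Fin n))
    (h : ∀ x, g x = 0 → (∀ i ∈ T, x i = 0) → x = 0) :
    Module.finrank F (LinearMap.ker g) ≤ T.card := by
  have := LinearMap.finrank_le_finrank_of_injective
    (f := (LinearMap.funLeft F F (fun i : T => (i : Fin n))).comp (LinearMap.ker g).subtype) ?_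
  · simpa using this
  · rw [← LinearMap.ker_eq_bot, LinearMap.ker_eq_bot']
    rintro ⟨x, hx⟩ h0
    refine Subtype.ext (h x hx fun i hi => ?_)
    exact congrFun h0 ⟨i, hi⟩

theorem two_mul_finrank_ker_le [DecidableEq F] (c : Fˣ) (d : Fin n → Fˣ)
    (σ : Equiv.Perm (Fin n)) :
    2 * Module.finrank F (LinearMap.ker (monomialMap d σ - algebraMap F _ (c : F))) +
      (nonscalarSet c d σ).card ≤ 2 * n := by
  set g := monomialMap d σ - algebraMap F _ (c : F) with hg
  have hx : ∀ x, g x = 0 → ∀ i, (d i : F) * x (σ i) = c * x i := by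
    intro x hx i
    have := congrFun hx i
    simpa [hg, sub_eq_zero] using this
  have hfix : ∀ x, g x = 0 → ∀ i, σ i = i → d i ≠ c → x i = 0 := by
    intro x hgx i hi hd
    have := hx x hgx i
    rw [hi] at this
    by_contra h0
    exact hd (Units.ext (mul_right_cancel₀ h0 this))
  have h1 : Module.finrank F (LinearMap.ker g) ≤
      (Finset.univ.filter fun i => i < σ i ∨ (d i = c ∧ σ i = i)).card := by
    refine finrank_ker_le_card _ fun x hgx h0 => funext fun i => ?_
    induction i using WellFoundedLT.induction with
    | _ i ih =>
    rcases lt_trichotomy i (σ i) with h | h | h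
    · exact h0 i (by simp [h])
    · by_cases hd : d i = c
      · exact h0 i (by simp [← h, hd])
      · exact hfix x hgx i h.symm hd
    · have := hx x hgx i
      rw [ih _ h] at this
      simpa using this.symm
  have h2 : Module.finrank F (LinearMap.ker g) ≤
      (Finset.univ.filter fun i => σ i < i ∨ (d i = c ∧ σ i = i)).card := by
    refine finrank_ker_le_card _ fun x hgx h0 => funext fun i => ?_
    induction i using WellFoundedGT.induction with
    | _ i ih =>
    rcases lt_trichotomy i (σ i) with h | h | h
    · have := hx x hgx i
      rw [ih _ h] at this
      simpa using this.symm
    · by_cases hd : d i = c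
      · exact h0 i (by simp [← h, hd])
      · exact hfix x hgx i h.symm hd
    · exact h0 i (by simp [h])
  have h3 : (Finset.univ.filter fun i => i < σ i ∨ (d i = c ∧ σ i = i)).card +
      (Finset.univ.filter fun i => σ i < i ∨ (d i = c ∧ σ i = i)).card +
      (nonscalarSet c d σ).card ≤ 2 * n := by
    simp only [nonscalarSet, Finset.card_filter, ← Finset.sum_add_distrib]
    refine (Finset.sum_le_card_nsmul _ _ 2 fun i _ => ?_).trans (by simp [mul_comm])
    rcases lt_trichotomy i (σ i) with h | h | h
    · simp [h, h.ne', h.not_gt]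
    · by_cases hd : d i = c <;> simp [← h, hd]
    · simp [h, h.ne, h.not_gt]
  omega

theorem map_sub_algebraMap_le {M : Type} [AddCommGroup M] [Module F M] {g : Module.End F M} (c : F)
    {V : Submodule F M} (h : V.map g ≤ V) : V.map (g - algebraMap F _ c) ≤ V := by
  rintro _ ⟨x, hx, rfl⟩
  simpa using V.sub_mem (h ⟨x, hx, rfl⟩) (V.smul_mem c hx)

variable [Fintype F]

theorem card_stable_le_of_fixed (d : Fin n → Fˣ) (σ : Equiv.Perm (Fin n)) :
    (Nat.card {V : Submodule F (Fin n → F) // V.map (monomialMap d σ) ≤ V} : ℝ) ≤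
      (Fintype.card F : ℝ) ^ (2 * (n : ℝ) + n ^ 2 / 6 +
        n * ((Finset.univ.filter fun i => σ i = i).card : ℝ)) := by
  have h := stableSum_coordSubspace_le (F := F) d σ Finset.univ (by simp) 0
  have htop : coordSubspace F (Finset.univ : Finset (Fin n)) = ⊤ := by
    rw [eq_top_iff]
    exact fun x _ i hi => absurd (Finset.mem_univ i) hi
  have hc : Nat.card {V : Submodule F (Fin n → F) // V.map (monomialMap d σ) ≤ V} =
      (stableFinset (monomialMap d σ) (coordSubspace F Finset.univ)).card := by
    rw [htop]
    exact Nat.subtype_card _ (by simp [mem_stableFinset])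
  simpa [stableSum, stableExponent, hc] using h

theorem card_stable_le_of_nonscalarSet [DecidableEq F] (c : Fˣ) (d : Fin n → Fˣ)
    (σ : Equiv.Perm (Fin n)) {δ : ℝ} (hδ0 : 0 ≤ δ) (hδ : δ ≤ 1 / 8)
    (hb : 4 * δ * n + (nonscalarSet c d σ).card ≤ n) :
    (Nat.card {V : Submodule F (Fin n → F) // V.map (monomialMap d σ) ≤ V} : ℝ) ≤
      ((n : ℝ) + 1) ^ 4 * (Fintype.card F : ℝ) ^ ((n : ℝ) ^ 2 / 4) *
        ((Fintype.card F : ℝ) ^ (-(δ * n))) ^ (nonscalarSet c d σ).card := by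
  have hq1 : (1 : ℝ) ≤ Fintype.card F := by exact_mod_cast Fintype.card_pos
  have hq0 : (0 : ℝ) < Fintype.card F := one_pos.trans_le hq1
  have h1 := finrank_ker_ge c d σ
  have h2 := two_mul_finrank_ker_le c d σ
  set g := monomialMap d σ - algebraMap F _ (c : F) with hg
  have h3 := LinearMap.finrank_range_add_finrank_ker g
  have h4 := card_stable_submodule_le g
  have h5 : Nat.card {V : Submodule F (Fin n → F) // V.map (monomialMap d σ) ≤ V} ≤
      Nat.card {V : Submodule F (Fin n → F) // V.map g ≤ V} :=
    Nat.card_le_card_of_injective (fun V => ⟨V.1, map_sub_algebraMap_le _ V.2⟩)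
      fun V V' h => Subtype.ext (Subtype.ext_iff.1 h :)
  refine (Nat.cast_le.2 h5).trans (h4.trans ?_)
  rw [Module.finrank_fin_fun] at h3 ⊢
  rw [mul_assoc, ← Real.rpow_natCast ((Fintype.card F : ℝ) ^ (-(δ * n))), ← Real.rpow_mul hq0.le,
    ← Real.rpow_add hq0]
  refine mul_le_mul_of_nonneg_left (Real.rpow_le_rpow_of_exponent_le hq1 ?_) (by positivity)
  generalize Module.finrank F (LinearMap.range g) = r at *
  generalize Module.finrank F (LinearMap.ker g) = s at *
  generalize (nonscalarSet c d σ).card = b at *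
  have h1' : (n : ℝ) ≤ s + b := by exact_mod_cast h1
  have h2' : 2 * (s : ℝ) + b ≤ 2 * n := by exact_mod_cast h2
  have h3' : (r : ℝ) = n - s := by rw [← h3]; push_cast; ring
  have hn : (0 : ℝ) ≤ n := Nat.cast_nonneg n
  have hb0 : (0 : ℝ) ≤ b := Nat.cast_nonneg b
  have hs0 : (0 : ℝ) ≤ s := Nat.cast_nonneg s
  rw [h3']
  have key : 2 * δ * n * b ≤ (n - s) * s := by
    rcases le_total ((n : ℝ) / 2) s with h | h
    · have e1 : (b / 2 : ℝ) * (n / 2) ≤ (n - s) * s :=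
        mul_le_mul (by linarith) h (by positivity) (by linarith)
      have e2 : δ * (n * b) ≤ 1 / 8 * (n * b) := mul_le_mul_of_nonneg_right hδ (by positivity)
      linarith
    · have e1 : (n / 2 : ℝ) * (4 * δ * n) ≤ (n - s) * s :=
        mul_le_mul (by linarith) (by linarith) (by positivity) (by linarith)
      have e2 : (δ * n) * b ≤ (δ * n) * n :=
        mul_le_mul_of_nonneg_left (by nlinarith) (by positivity)
      linarith
  linarith

theorem card_stable_le [DecidableEq F] (d : Fin n → Fˣ) (σ : Equiv.Perm (Fin n)) :
    (Nat.card {V : Submodule F (Fin n → F) // V.map (monomialMap d σ) ≤ V} : ℝ) ≤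
      (Fintype.card F : ℝ) ^ (2 * (n : ℝ) + 5 / 24 * n ^ 2) +
      ∑ c : Fˣ, ((n : ℝ) + 1) ^ 4 * (Fintype.card F : ℝ) ^ ((n : ℝ) ^ 2 / 4) *
        ((Fintype.card F : ℝ) ^ (-(1 / (96 * Fintype.card F : ℝ) * n))) ^
          (nonscalarSet c d σ).card := by
  have hq1 : (1 : ℝ) ≤ Fintype.card F := by exact_mod_cast Fintype.card_pos
  have hq0 : (0 : ℝ) < Fintype.card F := one_pos.trans_le hq1
  by_cases hf : 24 * (Finset.univ.filter fun i => σ i = i).card ≤ n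
  · refine (card_stable_le_of_fixed d σ).trans (le_add_of_le_of_nonneg ?_ (by positivity))
    refine Real.rpow_le_rpow_of_exponent_le hq1 ?_
    have hf' : 24 * ((Finset.univ.filter fun i => σ i = i).card : ℝ) ≤ n := by exact_mod_cast hf
    nlinarith [Nat.cast_nonneg (α := ℝ) n]
  · obtain ⟨c, hc⟩ : ∃ c : Fˣ, n + 24 * Fintype.card F * (nonscalarSet c d σ).card ≤
        24 * Fintype.card F * n := by
      by_contra! hall
      have hm : ∀ c : Fˣ, 24 * Fintype.card F *
          (Finset.univ.filter fun i => d i = c ∧ σ i = i).card ≤ n := by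
        intro c
        have h1 := Finset.card_filter_add_card_filter_not (s := (Finset.univ : Finset (Fin n)))
          (fun i => d i = c ∧ σ i = i)
        rw [Finset.card_univ, Fintype.card_fin] at h1
        have h2 := hall c
        rw [nonscalarSet] at h2
        nlinarith
      have hsum : ∑ c : Fˣ, (Finset.univ.filter fun i => d i = c ∧ σ i = i).card =
          (Finset.univ.filter fun i => σ i = i).card := by
        rw [Finset.card_eq_sum_card_fiberwise (f := d) (t := Finset.univ) (by simp)]
        simp only [Finset.filter_filter, and_comm]
      have h3 := Finset.sum_le_sum fun c (_ : c ∈ Finset.univ) => hm c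
      rw [← Finset.mul_sum, hsum, Finset.sum_const, Finset.card_univ, smul_eq_mul] at h3
      have h4 : Fintype.card Fˣ ≤ Fintype.card F :=
        Fintype.card_le_of_injective _ Units.val_injective
      have h5 : Fintype.card F * (24 * (Finset.univ.filter fun i => σ i = i).card) ≤
          Fintype.card F * n := by
        calc _ = 24 * Fintype.card F * (Finset.univ.filter fun i => σ i = i).card := by ring
          _ ≤ Fintype.card Fˣ * n := h3
          _ ≤ _ := Nat.mul_le_mul_right _ h4
      exact hf (Nat.le_of_mul_le_mul_left h5 Fintype.card_pos)
    refine le_add_of_nonneg_of_le (by positivity) (le_trans ?_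
      (Finset.single_le_sum (fun c _ => by positivity) (Finset.mem_univ c)))
    have hc' : (n : ℝ) + 24 * Fintype.card F * (nonscalarSet c d σ).card ≤
        24 * Fintype.card F * n := by exact_mod_cast hc
    refine card_stable_le_of_nonscalarSet c d σ (by positivity) ?_ ?_
    · rw [div_le_div_iff₀ (by positivity) (by positivity)]
      linarith
    · have : (4 * (1 / (96 * Fintype.card F : ℝ)) * n) = n / (24 * Fintype.card F) := by
        field_simp; ring
      rw [this, div_add' _ _ _ (by positivity), div_le_iff₀ (by positivity)]
      linarith

/-- Summed over all monomial maps other than the scalar `c`, the weights `y ^ b` with `b` the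
number of nonscalar coordinates form a small total. -/
theorem sum_pow_nonscalarSet_le [DecidableEq F] (c : Fˣ) {y : ℝ} (hy : 0 ≤ y) :
    ∑ p : (Fin n → Fˣ) × Equiv.Perm (Fin n),
      (if nonscalarSet c p.1 p.2 = ∅ then 0 else y ^ (nonscalarSet c p.1 p.2).card) ≤
      (1 + n * Fintype.card F * y) ^ n - 1 := by
  set w : Fin n → Fˣ × Fin n → ℝ := fun i z => if z = (c, i) then 1 else y with hw
  have hw0 : ∀ i z, 0 ≤ w i z := fun i z => by simp only [hw]; split_ifs <;> positivity
  have hprod : ∀ p : (Fin n → Fˣ) × Equiv.Perm (Fin n),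
      y ^ (nonscalarSet c p.1 p.2).card = ∏ i, w i (p.1 i, p.2 i) := by
    intro p
    simp only [hw, Prod.mk.injEq, Finset.prod_ite, Finset.prod_const, nonscalarSet, one_pow,
      one_mul]
  have hinj : Function.Injective fun (p : (Fin n → Fˣ) × Equiv.Perm (Fin n)) (i : Fin n) =>
      (p.1 i, p.2 i) := by
    rintro ⟨d, σ⟩ ⟨d', σ'⟩ h
    refine Prod.ext (funext fun i => ?_) (Equiv.ext fun i => ?_)
    · exact congrArg Prod.fst (congrFun h i)
    · exact congrArg Prod.snd (congrFun h i)
  have htotal : ∑ p : (Fin n → Fˣ) × Equiv.Perm (Fin n), y ^ (nonscalarSet c p.1 p.2).card ≤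
      ∑ u : Fin n → Fˣ × Fin n, ∏ i, w i (u i) := by
    rw [Finset.sum_congr rfl fun p _ => hprod p]
    refine (Finset.sum_map Finset.univ ⟨_, hinj⟩ fun u => ∏ i, w i (u i)).symm.trans_le ?_
    exact Finset.sum_le_sum_of_subset_of_nonneg (Finset.subset_univ _)
      fun u _ _ => Finset.prod_nonneg fun i _ => hw0 i _
  have hrow : ∀ i, ∑ z, w i z ≤ 1 + n * Fintype.card F * y := by
    intro i
    calc ∑ z, w i z ≤ ∑ z : Fˣ × Fin n, ((if z = (c, i) then 1 else 0) + y) := by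
          refine Finset.sum_le_sum fun z _ => ?_
          simp only [hw]
          split_ifs <;> linarith
      _ = 1 + Fintype.card Fˣ * n * y := by
          simp [Finset.sum_add_distrib]
      _ ≤ _ := by
          have h4 : (Fintype.card Fˣ : ℝ) ≤ Fintype.card F := by
            exact_mod_cast Fintype.card_le_of_injective _ Units.val_injective
          have : (Fintype.card Fˣ : ℝ) * (n * y) ≤ Fintype.card F * (n * y) :=
            mul_le_mul_of_nonneg_right h4 (by positivity)
          linarith
  have hbound : ∑ u : Fin n → Fˣ × Fin n, ∏ i, w i (u i) ≤
      (1 + n * Fintype.card F * y) ^ n := by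
    rw [← Fintype.prod_sum]
    refine (Finset.prod_le_prod (fun i _ => Finset.sum_nonneg fun z _ => hw0 i z)
      fun i _ => hrow i).trans_eq (by simp)
  have hone : nonscalarSet c (fun _ => c) (1 : Equiv.Perm (Fin n)) = ∅ := by
    simp [nonscalarSet]
  have hsplit : 1 + ∑ p : (Fin n → Fˣ) × Equiv.Perm (Fin n),
      (if nonscalarSet c p.1 p.2 = ∅ then 0 else y ^ (nonscalarSet c p.1 p.2).card) ≤
      ∑ p : (Fin n → Fˣ) × Equiv.Perm (Fin n), y ^ (nonscalarSet c p.1 p.2).card := by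
    calc _ = ∑ p : (Fin n → Fˣ) × Equiv.Perm (Fin n), ((if p = (fun _ => c, 1) then 1 else 0) +
          if nonscalarSet c p.1 p.2 = ∅ then 0 else y ^ (nonscalarSet c p.1 p.2).card) := by
          simp [Finset.sum_add_distrib]
      _ ≤ _ := by
          refine Finset.sum_le_sum fun p _ => ?_
          by_cases hp : p = (fun _ => c, 1)
          · subst hp
            simp [hone]
          · by_cases he : nonscalarSet c p.1 p.2 = ∅ <;> simp [hp, he]
  linarith

end MonomialFixedSpaces

section MonomialOrbits

variable {F : Type} [Field F] {n : ℕ}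

/-- The action of a matrix group on the subspaces of dimension `k` by taking images. -/
@[reducible]
noncomputable def grassmannianAction (G : Subgroup (GL (Fin n) F)) (k : ℕ) :
    MulAction G {V : Submodule F (Fin n → F) // Module.finrank F V = k} where
  smul g V := ⟨V.1.map (Matrix.toLin' (g.1 : Matrix (Fin n) (Fin n) F)), by
    have hinj : Function.Injective (Matrix.toLin' (g.1 : Matrix (Fin n) (Fin n) F)) := by
      refine Function.LeftInverse.injective (g := Matrix.toLin' (g.1⁻¹).1) fun x => ?_
      simp
    exact (Submodule.equivMapOfInjective _ hinj V.1).finrank_eq.symm.trans V.2⟩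
  one_smul V := Subtype.ext (by
    change V.1.map (Matrix.toLin' (1 : Matrix (Fin n) (Fin n) F)) = V.1
    rw [Matrix.toLin'_one, Submodule.map_id])
  mul_smul g h V := Subtype.ext (by
    change V.1.map (Matrix.toLin' (g.1.1 * h.1.1)) =
      (V.1.map (Matrix.toLin' h.1.1)).map (Matrix.toLin' g.1.1)
    rw [Matrix.toLin'_mul, Submodule.map_comp])

/-- Burnside's lemma for a matrix group acting on the subspaces of dimension `k`. -/
theorem numClassesDim_mul_card [Fintype F] (G : Subgroup (GL (Fin n) F)) [Fintype G] (k : ℕ) :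
    numClassesDim F G k * Fintype.card G =
      ∑ g : G, Nat.card {V : Submodule F (Fin n → F) //
        Module.finrank F V = k ∧ V.map (Matrix.toLin' (g.1 : Matrix (Fin n) (Fin n) F)) = V} := by
  classical
  let := grassmannianAction G k
  have : Fintype {V : Submodule F (Fin n → F) // Module.finrank F V = k} := Fintype.ofFinite _
  have : Fintype (Quotient (MulAction.orbitRel G
    {V : Submodule F (Fin n → F) // Module.finrank F V = k})) := Fintype.ofFinite _
  have h := MulAction.sum_card_fixedBy_eq_card_orbits_mul_card_group G
    {V : Submodule F (Fin n → F) // Module.finrank F V = k}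
  have hq : numClassesDim F G k = Fintype.card (Quotient (MulAction.orbitRel G
      {V : Submodule F (Fin n → F) // Module.finrank F V = k})) := by
    rw [numClassesDim, ← Nat.card_eq_fintype_card]
    refine Nat.card_congr (Quot.congrRight fun V W => ?_)
    refine Iff.trans ⟨?_, ?_⟩ (Setoid.comm' _)
    · rintro ⟨M, hM, h⟩
      exact ⟨⟨M, hM⟩, Subtype.ext h⟩
    · rintro ⟨M, h⟩
      exact ⟨M.1, M.2, congrArg Subtype.val h⟩
  rw [hq, ← h]
  refine Finset.sum_congr rfl fun g _ => ?_
  rw [← Nat.card_eq_fintype_card]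
  refine Nat.card_congr
    { toFun := fun V => ⟨V.1.1, V.1.2, congrArg Subtype.val V.2⟩
      invFun := fun V => ⟨⟨V.1, V.2.1⟩, Subtype.ext V.2.2⟩
      left_inv := fun _ => rfl
      right_inv := fun _ => rfl }

theorem monomialMap_mul (d d' : Fin n → Fˣ) (σ σ' : Equiv.Perm (Fin n)) :
    monomialMap d σ * monomialMap d' σ' = monomialMap (fun i => d i * d' (σ i)) (σ' * σ) := by
  refine LinearMap.ext fun x => funext fun i => ?_
  simp [mul_assoc]

theorem monomialMap_one : monomialMap (F := F) (n := n) (fun _ => 1) 1 = 1 := by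
  refine LinearMap.ext fun x => funext fun i => ?_
  simp

theorem monomialMap_mul_inv (d : Fin n → Fˣ) (σ : Equiv.Perm (Fin n)) :
    monomialMap d σ * monomialMap (fun i => (d (σ⁻¹ i))⁻¹) σ⁻¹ = 1 := by
  rw [monomialMap_mul, ← monomialMap_one]
  congr 1
  · funext i
    simp
  · simp

theorem monomialMap_injective :
    Function.Injective fun p : (Fin n → Fˣ) × Equiv.Perm (Fin n) => monomialMap p.1 p.2 := by
  rintro ⟨d, σ⟩ ⟨d', σ'⟩ h
  have hσ : σ = σ' := by
    refine Equiv.ext fun i => ?_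
    by_contra hne
    have := congrFun (LinearMap.congr_fun h (Pi.single (σ i) 1)) i
    simp [Ne.symm hne] at this
  subst hσ
  refine Prod.ext (funext fun i => Units.ext ?_) rfl
  have := congrFun (LinearMap.congr_fun h (Pi.single (σ i) 1)) i
  simpa using this

theorem exists_monomialMap {M : GL (Fin n) F} (hM : M ∈ MonomialGroup F n) :
    ∃ p : (Fin n → Fˣ) × Equiv.Perm (Fin n),
      Matrix.toLin' (M : Matrix (Fin n) (Fin n) F) = monomialMap p.1 p.2 := by
  induction hM using Subgroup.closure_induction with
  | mem M hM =>
    rcases hM with ⟨σ, hσ⟩ | ⟨d, hd⟩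
    · refine ⟨(fun _ => 1, σ), LinearMap.ext fun x => funext fun i => ?_⟩
      simp [hσ, Matrix.permMatrix_mulVec]
    · have hdet : IsUnit (Matrix.diagonal d).det := by
        rw [← hd]
        exact (Matrix.isUnit_iff_isUnit_det _).1 M.isUnit
      rw [Matrix.det_diagonal, isUnit_iff_ne_zero, Finset.prod_ne_zero_iff] at hdet
      refine ⟨(fun i => Units.mk0 (d i) (hdet i (Finset.mem_univ i)), 1),
        LinearMap.ext fun x => funext fun i => ?_⟩
      simp [hd, Matrix.mulVec_diagonal]
  | one => exact ⟨(fun _ => 1, 1), by simp [monomialMap_one, Module.End.one_eq_id]⟩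
  | mul M N _ _ hM hN =>
    obtain ⟨p, hp⟩ := hM
    obtain ⟨p', hp'⟩ := hN
    refine ⟨(fun i => p.1 i * p'.1 (p.2 i), p'.2 * p.2), ?_⟩
    rw [Units.val_mul, Matrix.toLin'_mul, hp, hp']
    exact monomialMap_mul _ _ _ _
  | inv M _ hM =>
    obtain ⟨p, hp⟩ := hM
    refine ⟨(fun i => (p.1 (p.2⁻¹ i))⁻¹, p.2⁻¹), ?_⟩
    have h1 : Matrix.toLin' (M⁻¹).1 * Matrix.toLin' M.1 = 1 := by
      rw [Module.End.mul_eq_comp, ← Matrix.toLin'_mul, Units.inv_mul, Matrix.toLin'_one]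
      rfl
    rw [hp] at h1
    exact left_inv_eq_right_inv h1 (monomialMap_mul_inv _ _)

theorem exists_mem_monomialGroup (p : (Fin n → Fˣ) × Equiv.Perm (Fin n)) :
    ∃ M ∈ MonomialGroup F n,
      Matrix.toLin' (M : Matrix (Fin n) (Fin n) F) = monomialMap p.1 p.2 := by
  have hd : IsUnit (Matrix.diagonal fun i => (p.1 i : F)) := by
    rw [Matrix.isUnit_iff_isUnit_det, Matrix.det_diagonal, isUnit_iff_ne_zero]
    exact Finset.prod_ne_zero_iff.2 fun i _ => (p.1 i).ne_zero
  have hσ : IsUnit (p.2.permMatrix F) := by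
    rw [Matrix.isUnit_iff_isUnit_det, Matrix.det_permutation]
    exact (Units.isUnit _).map (Int.castRingHom F)
  refine ⟨hd.unit * hσ.unit, mul_mem (Subgroup.subset_closure (Or.inr ⟨_, rfl⟩))
    (Subgroup.subset_closure (Or.inl ⟨_, rfl⟩)), LinearMap.ext fun x => funext fun i => ?_⟩
  rw [Units.val_mul, Matrix.toLin'_mul]
  simp [Matrix.permMatrix_mulVec, Matrix.mulVec_diagonal]

/-- Burnside's lemma for the monomial group. -/
theorem numClassesDim_monomialGroup_mul [Fintype F] [DecidableEq F] (k : ℕ) :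
    numClassesDim F (MonomialGroup F n) k * (n.factorial * Fintype.card Fˣ ^ n) =
      ∑ p : (Fin n → Fˣ) × Equiv.Perm (Fin n), Nat.card {V : Submodule F (Fin n → F) //
        Module.finrank F V = k ∧ V.map (monomialMap p.1 p.2) = V} := by
  have : Fintype (MonomialGroup F n) := Fintype.ofFinite _
  choose e he using fun M : MonomialGroup F n => exists_monomialMap M.2
  have hbij : Function.Bijective e := by
    refine ⟨fun M N h => Subtype.ext (Units.ext ?_), fun p => ?_⟩
    · apply Matrix.toLin'.injective
      rw [he, he, h]
    · obtain ⟨M, hM, h⟩ := exists_mem_monomialGroup p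
      exact ⟨⟨M, hM⟩, monomialMap_injective ((he ⟨M, hM⟩).symm.trans h)⟩
  have h := numClassesDim_mul_card (MonomialGroup F n) k
  rw [Fintype.card_of_bijective hbij, Fintype.card_prod, Fintype.card_fun, Fintype.card_perm,
    Fintype.card_fin, mul_comm (_ ^ _)] at h
  rw [h]
  exact Fintype.sum_bijective e hbij _ _ fun M => by rw [he]

end MonomialOrbits

section MonomialCount

variable {F : Type} [Field F] {n : ℕ}

theorem card_grassmannian_fin [Fintype F] {k : ℕ} (hk : k ≤ n) :
    (Nat.card {V : Submodule F (Fin n → F) // Module.finrank F V = k} : ℝ) =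
      qBinom (Fintype.card F) n k := by
  rw [card_grassmannian (by simpa using hk), Module.finrank_fin_fun]

variable [DecidableEq F]

theorem nonscalarSet_eq_empty {c : Fˣ} {p : (Fin n → Fˣ) × Equiv.Perm (Fin n)} :
    nonscalarSet c p.1 p.2 = ∅ ↔ p = (fun _ => c, 1) := by
  simp only [nonscalarSet, Finset.filter_eq_empty_iff, Finset.mem_univ, not_not, true_imp_iff,
    forall_and, Prod.ext_iff, funext_iff, Equiv.ext_iff, Equiv.Perm.one_apply]

variable [Fintype F]

theorem card_units_mul_qBinom_le {k : ℕ} (hn : n ≠ 0) (hk : k ≤ n) :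
    Fintype.card Fˣ * qBinom (Fintype.card F) n k ≤
      numClassesDim F (MonomialGroup F n) k * ((n.factorial : ℝ) * (Fintype.card Fˣ : ℝ) ^ n) := by
  have : NeZero n := ⟨hn⟩
  have h := numClassesDim_monomialGroup_mul (F := F) (n := n) k
  rw [← card_grassmannian_fin hk]
  have hinj : Function.Injective fun c : Fˣ =>
      ((fun _ => c, 1) : (Fin n → Fˣ) × Equiv.Perm (Fin n)) := fun c c' h =>
    congrFun (congrArg Prod.fst h) 0
  have h2 : Fintype.card Fˣ * Nat.card {V : Submodule F (Fin n → F) // Module.finrank F V = k} ≤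
      numClassesDim F (MonomialGroup F n) k * (n.factorial * Fintype.card Fˣ ^ n) := by
    rw [h]
    calc _ = ∑ c : Fˣ, Nat.card {V : Submodule F (Fin n → F) //
          Module.finrank F V = k ∧ V.map (monomialMap (fun _ => c) 1) = V} := by
          rw [← smul_eq_mul, ← Finset.card_univ, ← Finset.sum_const]
          refine Finset.sum_congr rfl fun c _ => Nat.card_congr (Equiv.subtypeEquivRight
            fun V => ⟨fun hV => ⟨hV, ?_⟩, fun hV => hV.1⟩)
          have : monomialMap (fun _ : Fin n => c) 1 = (c : F) • LinearMap.id := by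
            refine LinearMap.ext fun x => funext fun i => ?_
            simp
          rw [this, Submodule.map_smul _ _ _ c.ne_zero, Submodule.map_id]
      _ ≤ _ := by
          refine (Finset.sum_map Finset.univ ⟨_, hinj⟩
            fun p : (Fin n → Fˣ) × Equiv.Perm (Fin n) => Nat.card {V : Submodule F (Fin n → F) //
              Module.finrank F V = k ∧ V.map (monomialMap p.1 p.2) = V}).symm.trans_le ?_
          exact Finset.sum_le_sum_of_subset (Finset.subset_univ _)
  exact_mod_cast h2

theorem numClassesDim_mul_le {k : ℕ} (hk : k ≤ n) :
    numClassesDim F (MonomialGroup F n) k * ((n.factorial : ℝ) * (Fintype.card Fˣ : ℝ) ^ n) ≤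
      Fintype.card Fˣ * qBinom (Fintype.card F) n k +
      (n.factorial * (Fintype.card Fˣ : ℝ) ^ n *
          (Fintype.card F : ℝ) ^ (2 * (n : ℝ) + 5 / 24 * n ^ 2) +
        Fintype.card Fˣ * (((n : ℝ) + 1) ^ 4 * (Fintype.card F : ℝ) ^ ((n : ℝ) ^ 2 / 4) *
          ((1 + n * Fintype.card F *
            (Fintype.card F : ℝ) ^ (-(1 / (96 * Fintype.card F : ℝ) * n))) ^ n - 1))) := by
  have h := congrArg (Nat.cast (R := ℝ)) (numClassesDim_monomialGroup_mul (F := F) (n := n) k)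
  push_cast at h
  rw [h]
  set B := (Fintype.card F : ℝ) ^ (2 * (n : ℝ) + 5 / 24 * n ^ 2)
  set K := ((n : ℝ) + 1) ^ 4 * (Fintype.card F : ℝ) ^ ((n : ℝ) ^ 2 / 4) with hK
  set y := (Fintype.card F : ℝ) ^ (-(1 / (96 * Fintype.card F : ℝ) * n))
  set Gr := qBinom (Fintype.card F) n k with hGr
  have hGr0 : 0 ≤ Gr := by rw [hGr, ← card_grassmannian_fin hk]; positivity
  have hB0 : 0 ≤ B := by positivity
  have hy0 : 0 ≤ y := by positivity
  have hK0 : 0 ≤ K := by positivity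
  have hterm : ∀ p : (Fin n → Fˣ) × Equiv.Perm (Fin n), (Nat.card {V : Submodule F (Fin n → F) //
      Module.finrank F V = k ∧ V.map (monomialMap p.1 p.2) = V} : ℝ) ≤
      ∑ c : Fˣ, (if p = (fun _ => c, 1) then Gr else 0) + (B + ∑ c : Fˣ, K *
        if nonscalarSet c p.1 p.2 = ∅ then 0 else y ^ (nonscalarSet c p.1 p.2).card) := by
    intro p
    by_cases hp : ∃ c : Fˣ, p = (fun _ => c, 1)
    · obtain ⟨c, hc⟩ := hp
      refine le_add_of_le_of_nonneg ?_ ?_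
      · refine le_trans ?_ (Finset.single_le_sum (fun c _ => ?_) (Finset.mem_univ c))
        · rw [if_pos hc, hGr, ← card_grassmannian_fin hk, Nat.cast_le]
          exact Nat.card_le_card_of_injective (fun V => ⟨V.1, V.2.1⟩)
            fun V V' h => Subtype.ext (Subtype.ext_iff.1 h :)
        · split_ifs <;> positivity
      · refine add_nonneg hB0 (Finset.sum_nonneg fun c _ => mul_nonneg hK0 ?_)
        split_ifs <;> positivity
    · push Not at hp
      refine le_add_of_nonneg_of_le (Finset.sum_nonneg fun c _ => by split_ifs <;> positivity) ?_
      refine le_trans ?_ ((card_stable_le p.1 p.2).trans_eq ?_)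
      · rw [Nat.cast_le]
        exact Nat.card_le_card_of_injective (fun V => ⟨V.1, V.2.2.le⟩)
            fun V V' h => Subtype.ext (Subtype.ext_iff.1 h :)
      · congr 1
        refine Finset.sum_congr rfl fun c _ => ?_
        rw [if_neg fun he => hp c (nonscalarSet_eq_empty.1 he)]
  refine (Finset.sum_le_sum fun p _ => hterm p).trans ?_
  rw [Finset.sum_add_distrib, Finset.sum_add_distrib]
  refine add_le_add ?_ (add_le_add ?_ ?_)
  · rw [Finset.sum_comm]
    simp
  · simp [Fintype.card_perm, mul_comm]
  · rw [Finset.sum_comm]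
    calc _ ≤ ∑ c : Fˣ, K * ((1 + n * Fintype.card F * y) ^ n - 1) := by
          refine Finset.sum_le_sum fun c _ => ?_
          rw [← Finset.mul_sum]
          exact mul_le_mul_of_nonneg_left (sum_pow_nonscalarSet_le c hy0) hK0
      _ = _ := by simp

end MonomialCount

section Asymptotics

theorem tendsto_pow_mul_rpow_neg {Q δ : ℝ} (hQ : 1 < Q) (hδ : 0 < δ) (a : ℕ) :
    Tendsto (fun n : ℕ => (n : ℝ) ^ a * Q ^ (-(δ * n))) atTop (𝓝 0) := by
  have hQ0 : 0 < Q := one_pos.trans hQ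
  have h := tendsto_pow_const_mul_const_pow_of_abs_lt_one a (r := Q ^ (-δ)) (by
    rw [abs_of_pos (by positivity)]
    exact Real.rpow_lt_one_of_one_lt_of_neg hQ (neg_lt_zero.2 hδ))
  refine h.congr fun n => ?_
  rw [← Real.rpow_natCast (Q ^ (-δ)), ← Real.rpow_mul hQ0.le, neg_mul]

theorem tendsto_pow_self_zero {f : ℕ → ℝ} (hf0 : ∀ n, 0 ≤ f n) (hf : Tendsto f atTop (𝓝 0)) :
    Tendsto (fun n => f n ^ n) atTop (𝓝 0) := by
  refine squeeze_zero' (Eventually.of_forall fun n => pow_nonneg (hf0 n) n) ?_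
    (tendsto_pow_atTop_nhds_zero_of_lt_one (r := (1 / 2 : ℝ)) (by norm_num) (by norm_num))
  filter_upwards [hf.eventually_le_const (show (0 : ℝ) < 1 / 2 by norm_num)] with n hn
  exact pow_le_pow_left₀ (hf0 n) hn n

theorem one_add_pow_sub_one_le {t : ℝ} (ht : 0 ≤ t) {n : ℕ} (hnt : n * t ≤ 1) :
    (1 + t) ^ n - 1 ≤ 2 * (n * t) := by
  have h1 : (1 + t) ^ n ≤ Real.exp (n * t) := by
    rw [Real.exp_nat_mul]
    exact pow_le_pow_left₀ (by positivity) (by linarith [Real.add_one_le_exp t]) n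
  have h0 : 0 ≤ n * t := by positivity
  have h2 := Real.abs_exp_sub_one_le (x := n * t) (by rwa [abs_of_nonneg h0])
  rw [abs_of_nonneg h0] at h2
  linarith [le_abs_self (Real.exp (n * t) - 1)]

theorem tendsto_error_term {Q δ : ℝ} (hQ : 1 < Q) (hδ : 0 < δ) :
    Tendsto (fun n : ℕ => ((n : ℝ) + 1) ^ 4 * Q ^ (δ / 2 * n) *
      ((1 + n * Q * Q ^ (-(δ * n))) ^ n - 1)) atTop (𝓝 0) := by
  have hQ0 : 0 < Q := one_pos.trans hQ
  have h1 : Tendsto (fun n : ℕ => Q * ((n : ℝ) ^ 2 * Q ^ (-(δ * n)))) atTop (𝓝 0) := by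
    simpa using (tendsto_pow_mul_rpow_neg hQ hδ 2).const_mul Q
  have h2 : Tendsto (fun n : ℕ => 32 * Q * ((n : ℝ) ^ 6 * Q ^ (-(δ / 2 * n)))) atTop (𝓝 0) := by
    simpa using (tendsto_pow_mul_rpow_neg hQ (half_pos hδ) 6).const_mul (32 * Q)
  refine squeeze_zero' (Eventually.of_forall fun n => mul_nonneg (by positivity) ?_) ?_ h2
  · exact sub_nonneg.2 (one_le_pow₀ (le_add_of_nonneg_right (by positivity)))
  filter_upwards [h1.eventually_le_const one_pos, eventually_ge_atTop 1] with n hn hn1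
  have hn1' : (1 : ℝ) ≤ n := by exact_mod_cast hn1
  have h3 := one_add_pow_sub_one_le (t := n * Q * Q ^ (-(δ * n))) (n := n) (by positivity)
    (le_of_eq_of_le (by ring) hn)
  have h4 : ((n : ℝ) + 1) ^ 4 ≤ (2 * n) ^ 4 := pow_le_pow_left₀ (by positivity) (by linarith) 4
  have h5 : Q ^ (δ / 2 * n) * Q ^ (-(δ * n)) = Q ^ (-(δ / 2 * n)) := by
    rw [← Real.rpow_add hQ0]
    congr 1
    ring
  calc _ ≤ (2 * n : ℝ) ^ 4 * Q ^ (δ / 2 * n) * (2 * (n * (n * Q * Q ^ (-(δ * n))))) := by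
        refine mul_le_mul (mul_le_mul_of_nonneg_right h4 (by positivity)) h3 ?_ (by positivity)
        exact sub_nonneg.2 (one_le_pow₀ (le_add_of_nonneg_right (by positivity)))
    _ = 32 * Q * ((n : ℝ) ^ 6 * (Q ^ (δ / 2 * n) * Q ^ (-(δ * n)))) := by ring
    _ = _ := by rw [h5]

theorem tendsto_main_error {Q : ℝ} (hQ : 1 < Q) :
    Tendsto (fun n : ℕ => ((n : ℝ) * Q ^ (4 - (n : ℝ) / 24)) ^ n) atTop (𝓝 0) := by
  have hQ0 : 0 < Q := one_pos.trans hQ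
  refine tendsto_pow_self_zero (fun n => by positivity) ?_
  have h := (tendsto_pow_mul_rpow_neg hQ (show (0 : ℝ) < 1 / 24 by norm_num) 1).const_mul
    (Q ^ (4 : ℝ))
  rw [mul_zero] at h
  refine h.congr fun n => ?_
  rw [sub_eq_add_neg, Real.rpow_add hQ0, pow_one]
  ring_nf

/-- Comparing the number of monomial classes with the number of subspaces, once the latter is
large. -/
theorem numClassesDim_div_bounds {F : Type} [Field F] [Fintype F] {n k : ℕ} (hn : n ≠ 0)
    (hk : k ≤ n) {ε : ℝ} (hε : ε ≤ 1)
    (hGr : (Fintype.card F : ℝ) ^ ((n : ℝ) ^ 2 / 4 - ε * n) ≤ qBinom (Fintype.card F) n k) :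
    1 ≤ (numClassesDim F (MonomialGroup F n) k : ℝ) / (qBinom (Fintype.card F) n k /
        ((n.factorial : ℝ) * ((Fintype.card F : ℝ) - 1) ^ (n - 1))) ∧
    (numClassesDim F (MonomialGroup F n) k : ℝ) / (qBinom (Fintype.card F) n k /
        ((n.factorial : ℝ) * ((Fintype.card F : ℝ) - 1) ^ (n - 1))) ≤
      1 + (((n : ℝ) * (Fintype.card F : ℝ) ^ (4 - (n : ℝ) / 24)) ^ n +
        ((n : ℝ) + 1) ^ 4 * (Fintype.card F : ℝ) ^ (ε * n) *
          ((1 + n * Fintype.card F *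
            (Fintype.card F : ℝ) ^ (-(1 / (96 * Fintype.card F : ℝ) * n))) ^ n - 1)) := by
  classical
  have hlow := card_units_mul_qBinom_le (F := F) hn hk
  have hup := numClassesDim_mul_le (F := F) hk
  have hu : (Fintype.card Fˣ : ℝ) = (Fintype.card F : ℝ) - 1 := by
    rw [Fintype.card_units, Nat.cast_sub Fintype.card_pos, Nat.cast_one]
  have hu0 : (0 : ℝ) < Fintype.card Fˣ := by exact_mod_cast Fintype.card_pos
  have hQ1 : (1 : ℝ) ≤ Fintype.card F := by linarith
  have hQ0 : (0 : ℝ) < Fintype.card F := by linarith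
  rw [← hu]
  have huQ : (Fintype.card Fˣ : ℝ) ≤ Fintype.card F := by linarith
  set N : ℝ := (numClassesDim F (MonomialGroup F n) k : ℝ)
  set Gr := qBinom (Fintype.card F) n k
  set u : ℝ := (Fintype.card Fˣ : ℝ)
  set Q : ℝ := (Fintype.card F : ℝ)
  have hG0 : 0 < Q ^ ((n : ℝ) ^ 2 / 4 - ε * n) := by positivity
  have hGr0 : 0 < Gr := hG0.trans_le hGr
  have hpow : u ^ n = u * u ^ (n - 1) := (mul_pow_sub_one hn u).symm
  set X := (1 + n * Q * Q ^ (-(1 / (96 * Q) * n))) ^ n - 1 with hX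
  have hX0 : 0 ≤ X := sub_nonneg.2 (one_le_pow₀ (le_add_of_nonneg_right (by positivity)))
  rw [div_div_eq_mul_div, le_div_iff₀ hGr0, div_le_iff₀ hGr0]
  constructor
  · refine le_of_mul_le_mul_left ?_ hu0
    calc u * (1 * Gr) = u * Gr := by ring
      _ ≤ _ := hlow
      _ = _ := by rw [hpow]; ring
  · have h1 : (n.factorial : ℝ) * u ^ (n - 1) * Q ^ (2 * (n : ℝ) + 5 / 24 * n ^ 2) ≤
        (n * Q ^ (4 - (n : ℝ) / 24)) ^ n * Q ^ ((n : ℝ) ^ 2 / 4 - ε * n) := by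
      have e1 : (n.factorial : ℝ) ≤ (n : ℝ) ^ n := by exact_mod_cast n.factorial_le_pow
      have e2 : u ^ (n - 1) ≤ Q ^ n :=
        (pow_le_pow_left₀ hu0.le huQ _).trans (pow_le_pow_right₀ hQ1 (Nat.sub_le n 1))
      calc _ ≤ (n : ℝ) ^ n * Q ^ n * Q ^ (2 * (n : ℝ) + 5 / 24 * n ^ 2) := by gcongr
        _ = (n : ℝ) ^ n * Q ^ (3 * (n : ℝ) + 5 / 24 * n ^ 2) := by
            rw [mul_assoc, ← Real.rpow_natCast Q n, ← Real.rpow_add hQ0]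
            ring_nf
        _ ≤ (n : ℝ) ^ n * Q ^ ((4 - (n : ℝ) / 24) * n + ((n : ℝ) ^ 2 / 4 - ε * n)) := by
            refine mul_le_mul_of_nonneg_left (Real.rpow_le_rpow_of_exponent_le hQ1 ?_)
              (by positivity)
            have : ε * n ≤ 1 * n := mul_le_mul_of_nonneg_right hε (Nat.cast_nonneg n)
            nlinarith
        _ = _ := by
            rw [mul_pow, ← Real.rpow_natCast (Q ^ (4 - (n : ℝ) / 24)), ← Real.rpow_mul hQ0.le,
              mul_assoc, ← Real.rpow_add hQ0]
    have h2 : Q ^ ((n : ℝ) ^ 2 / 4) = Q ^ (ε * n) * Q ^ ((n : ℝ) ^ 2 / 4 - ε * n) := by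
      rw [← Real.rpow_add hQ0]
      ring_nf
    refine le_of_mul_le_mul_left ?_ hu0
    calc u * (N * (n.factorial * u ^ (n - 1))) = N * (n.factorial * u ^ n) := by rw [hpow]; ring
      _ ≤ _ := hup
      _ = u * (Gr + (n.factorial * u ^ (n - 1) * Q ^ (2 * (n : ℝ) + 5 / 24 * n ^ 2) +
          ((n : ℝ) + 1) ^ 4 * Q ^ ((n : ℝ) ^ 2 / 4) * X)) := by rw [hpow]; ring
      _ ≤ u * (Gr + ((n * Q ^ (4 - (n : ℝ) / 24)) ^ n * Gr +
          ((n : ℝ) + 1) ^ 4 * (Q ^ (ε * n) * Gr) * X)) := by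
          rw [h2]
          refine mul_le_mul_of_nonneg_left (add_le_add le_rfl (add_le_add
            (h1.trans (mul_le_mul_of_nonneg_left hGr (by positivity))) ?_)) hu0.le
          gcongr
      _ = _ := by ring

end Asymptotics

theorem stmt0 (q : ℕ) (F : Type) [Field F] [Fintype F] (hq : Fintype.card F = q) :
    ∃ A > (0 : ℝ), ∃ ε > (0 : ℝ), ∀ k : ℕ → ℕ, (∀ n, k n ≤ n) → StarCond A ε k →
      Tendsto (fun n : ℕ => (numClassesDim F (MonomialGroup F n) (k n) : ℝ) /
          (qBinom q n (k n) / ((n.factorial : ℝ) * ((q : ℝ) - 1) ^ (n - 1))))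
        atTop (𝓝 1) := by
  subst hq
  have hQ : 1 < (Fintype.card F : ℝ) := by exact_mod_cast Fintype.one_lt_card (α := F)
  have hδ : 0 < 1 / (96 * Fintype.card F : ℝ) := by positivity
  refine ⟨1, one_pos, 1 / (96 * Fintype.card F : ℝ) / 2, half_pos hδ, fun k hk hstar => ?_⟩
  have hε : 1 / (96 * Fintype.card F : ℝ) / 2 ≤ 1 := by
    rw [div_div, div_le_one (by positivity)]
    linarith
  have hbounds : ∀ᶠ n : ℕ in atTop, n ≠ 0 ∧ (Fintype.card F : ℝ) ^ ((n : ℝ) ^ 2 / 4 -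
      1 / (96 * Fintype.card F : ℝ) / 2 * n) ≤ qBinom (Fintype.card F) n (k n) := by
    filter_upwards [hstar.eventually_le_atBot 0, eventually_ne_atTop 0] with n hn hn0
    refine ⟨hn0, le_trans ?_ (pow_le_qBinom (Fintype.one_lt_card (α := F)) (hk n))⟩
    rw [← Real.rpow_natCast _ (k n * (n - k n))]
    refine Real.rpow_le_rpow_of_exponent_le hQ.le ?_
    rw [Nat.cast_mul, Nat.cast_sub (hk n)]
    linarith [Real.sqrt_nonneg (n : ℝ)]
  have herr := ((tendsto_main_error hQ).add (tendsto_error_term hQ hδ)).const_add 1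
  rw [add_zero, add_zero] at herr
  refine tendsto_of_tendsto_of_tendsto_of_le_of_le' tendsto_const_nhds herr ?_ ?_
  · filter_upwards [hbounds] with n hn
    exact (numClassesDim_div_bounds hn.1 (hk n) hε hn.2).1
  · filter_upwards [hbounds] with n hn
    exact (numClassesDim_div_bounds hn.1 (hk n) hε hn.2).2
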